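/- In Cl(4,2), set E = ι(e₂)ι(e₅), g = ι(e₂)ι(e₃) + ι(e₂)ι(e₆), f = ι(e₃)ι(e₅) − ι(e₅)ι(e₆). For φ ∈ ℝ let R = cos φ · 1 + sin φ · E and R̄ = cos φ · 1 − sin φ · E. Then R · R̄ = 1, and for every point representation 𝔭 = 2E + x₀ f + y₀ g (x₀, y₀ ∈ ℝ): R · 𝔭 · R̄ = 2E + (x₀ cos 2φ + y₀ sin 2φ) f + (y₀ cos 2φ − x₀ sin 2φ) g; i.e. the sandwich action of R is the rotation about the origin by the angle 2φ. -/

import Mathlib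

/-- The bilinear form on `ℝ⁶` whose matrix has entries `B₂₂ = B₅₅ = 1`,
`B₁₃ = B₃₁ = B₄₆ = B₆₄ = −1` (indices 0-based here). -/
noncomputable def B6 : LinearMap.BilinMap ℝ (Fin 6 → ℝ) ℝ :=
  LinearMap.mk₂ ℝ
    (fun u w => u 1 * w 1 + u 4 * w 4 - u 0 * w 2 - u 2 * w 0 - u 3 * w 5 - u 5 * w 3)
    (by intros; simp only [Pi.add_apply]; ring)
    (by intros; simp only [Pi.smul_apply, smul_eq_mul]; ring)
    (by intros; simp only [Pi.add_apply]; ring)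
    (by intros; simp only [Pi.smul_apply, smul_eq_mul]; ring)

/-- The quadratic form `Q(v) = v₂² + v₅² − 2v₁v₃ − 2v₄v₆` on `ℝ⁶`, of signature `(4,2)`. -/
noncomputable def Q6 : QuadraticForm ℝ (Fin 6 → ℝ) := B6.toQuadraticMap

/-- The standard basis of `ℝ⁶`; `e i` corresponds to `e_{i+1}` in the paper. -/
noncomputable def e (i : Fin 6) : Fin 6 → ℝ := Pi.single i 1

open CliffordAlgebra

/-- `E = e₂e₅`. -/
noncomputable def E : CliffordAlgebra Q6 := ι Q6 (e 1) * ι Q6 (e 4)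

/-- `g = e₂e₃ + e₂e₆`, corresponding to `e_{23} + e_{26}` in the paper. -/
noncomputable def g : CliffordAlgebra Q6 := ι Q6 (e 1) * ι Q6 (e 2) + ι Q6 (e 1) * ι Q6 (e 5)

/-- `f = e₃e₅ − e₅e₆`, corresponding to `e_{35} − e_{56}` in the paper. -/
noncomputable def f : CliffordAlgebra Q6 := ι Q6 (e 2) * ι Q6 (e 4) - ι Q6 (e 4) * ι Q6 (e 5)

/-- The rotation element `R = cos φ · 1 + sin φ · E`. -/
noncomputable def R (φ : ℝ) : CliffordAlgebra Q6 :=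
  Real.cos φ • (1 : CliffordAlgebra Q6) + Real.sin φ • E

/-- The reversed rotation element `R̄ = cos φ · 1 − sin φ · E`. -/
noncomputable def Rbar (φ : ℝ) : CliffordAlgebra Q6 :=
  Real.cos φ • (1 : CliffordAlgebra Q6) - Real.sin φ • E

theorem ι_e_mul_swap {i j : Fin 6} (h : QuadraticMap.polar Q6 (e i) (e j) = 0) :
    ι Q6 (e i) * ι Q6 (e j) = -(ι Q6 (e j) * ι Q6 (e i)) := by
  rw [eq_neg_iff_add_eq_zero, ι_mul_ι_add_swap, h, map_zero]

theorem Q6_apply (v : Fin 6 → ℝ) :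
    Q6 v = v 1 * v 1 + v 4 * v 4 - v 0 * v 2 - v 2 * v 0 - v 3 * v 5 - v 5 * v 3 := rfl

theorem polar_Q6 (u w : Fin 6 → ℝ) :
    QuadraticMap.polar Q6 u w =
      2 * (u 1 * w 1 + u 4 * w 4 - u 0 * w 2 - u 2 * w 0 - u 3 * w 5 - u 5 * w 3) := by
  simp only [QuadraticMap.polar, Q6_apply, Pi.add_apply]
  ring

theorem ι_e_one_mul_self : ι Q6 (e 1) * ι Q6 (e 1) = 1 := by
  rw [ι_sq_scalar]
  simp [Q6_apply, e]

theorem ι_e_four_mul_self : ι Q6 (e 4) * ι Q6 (e 4) = 1 := by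
  rw [ι_sq_scalar]
  simp [Q6_apply, e]

theorem ι_e_four_mul_ι_e_one : ι Q6 (e 4) * ι Q6 (e 1) = -(ι Q6 (e 1) * ι Q6 (e 4)) :=
  ι_e_mul_swap (by simp [polar_Q6, e])

/-- The null direction `e₃ + e₆` shared by `f` and `g` anticommutes with `e₂`. -/
theorem add_mul_ι_e_one :
    (ι Q6 (e 2) + ι Q6 (e 5)) * ι Q6 (e 1) = -(ι Q6 (e 1) * (ι Q6 (e 2) + ι Q6 (e 5))) := by
  rw [add_mul, mul_add, ι_e_mul_swap (i := 2) (j := 1) (by simp [polar_Q6, e]),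
    ι_e_mul_swap (i := 5) (j := 1) (by simp [polar_Q6, e]), neg_add]

theorem g_eq : g = ι Q6 (e 1) * (ι Q6 (e 2) + ι Q6 (e 5)) := (mul_add _ _ _).symm

theorem f_eq : f = (ι Q6 (e 2) + ι Q6 (e 5)) * ι Q6 (e 4) := by
  rw [f, add_mul, ι_e_mul_swap (i := 4) (j := 5) (by simp [polar_Q6, e]),
    sub_neg_eq_add]

theorem f_eq_neg : f = -(ι Q6 (e 4) * (ι Q6 (e 2) + ι Q6 (e 5))) := by
  rw [f, mul_add, ι_e_mul_swap (i := 2) (j := 4) (by simp [polar_Q6, e])]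
  abel

theorem E_mul_E : E * E = -1 := by
  calc E * E = ι Q6 (e 1) * (ι Q6 (e 4) * ι Q6 (e 1)) * ι Q6 (e 4) := by
        simp only [E, mul_assoc]
    _ = -(ι Q6 (e 1) * ι Q6 (e 1) * (ι Q6 (e 4) * ι Q6 (e 4))) := by
        rw [ι_e_four_mul_ι_e_one]
        simp only [mul_neg, neg_mul, mul_assoc]
    _ = -1 := by rw [ι_e_one_mul_self, ι_e_four_mul_self, one_mul]

theorem E_mul_f : E * f = -g := by
  rw [f_eq_neg, g_eq, E, mul_neg, mul_assoc, ← mul_assoc (ι Q6 (e 4)) (ι Q6 (e 4)),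
    ι_e_four_mul_self, one_mul]

theorem E_mul_g : E * g = f := by
  rw [f_eq_neg, g_eq, E, ← neg_eq_iff_eq_neg.mpr ι_e_four_mul_ι_e_one, neg_mul, mul_assoc,
    ← mul_assoc (ι Q6 (e 1)) (ι Q6 (e 1)), ι_e_one_mul_self, one_mul]

theorem g_mul_E : g * E = -f := by
  rw [f_eq, g_eq, ← neg_eq_iff_eq_neg.mpr add_mul_ι_e_one, E, neg_mul, mul_assoc,
    ← mul_assoc (ι Q6 (e 1)) (ι Q6 (e 1)), ι_e_one_mul_self, one_mul]

theorem f_mul_E : f * E = g := by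
  rw [← E_mul_g, mul_assoc, g_mul_E, mul_neg, E_mul_f, neg_neg]

/-- `R·R̄ = 1`, and the sandwich action of `R` on the point
representation `𝔭 = 2E + x₀f + y₀g` is the rotation about the origin by angle `2φ`. -/
theorem rotation_sandwich (φ : ℝ) :
    R φ * Rbar φ = 1 ∧
      ∀ x₀ y₀ : ℝ,
        R φ * ((2 : ℝ) • E + x₀ • f + y₀ • g) * Rbar φ =
          (2 : ℝ) • E + (x₀ * Real.cos (2 * φ) + y₀ * Real.sin (2 * φ)) • f +
            (y₀ * Real.cos (2 * φ) - x₀ * Real.sin (2 * φ)) • g := by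
  have h := Real.sin_sq_add_cos_sq φ
  constructor
  · simp only [R, Rbar, add_mul, mul_sub, smul_mul_assoc, mul_smul_comm, one_mul, mul_one, E_mul_E]
    match_scalars
    · linear_combination h
    · ring
  · intro x₀ y₀
    simp only [R, Rbar, add_mul, mul_add, mul_sub, smul_mul_assoc, mul_smul_comm, one_mul, mul_one,
      neg_mul, E_mul_E, E_mul_f, E_mul_g, f_mul_E, g_mul_E, Real.cos_two_mul', Real.sin_two_mul]
    match_scalars
    · linear_combination 2 * h
    all_goals ring
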